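/- Fix β ∈ ℝ and smooth a, b₁ : ℝ → ℝ with all derivatives bounded by C_{Nℓ} e^{-N|y|} for every N, ℓ, b = b₀ + b₁ (b₀ constant), δ(y) = (3/8)β a(y)², φ(ρ,y) = ρ + δ(y) ln ρ + b(y), and V₀(ρ,y) = a(y) cos φ(ρ,y). Let Ψ(V) = ∂_ρ²V + (1 + (β/ρ)V² + 1/(4ρ²))V − ρ^{-2}∂_y²V, and let S_k, S°_k be the classes of finite sums Σ_{n} Σ_{i ≤ I, j ≥ k} (a_{ijn}(y) cos nφ + b_{ijn}(y) sin nφ)(ln^i ρ)/ρ^j with exponentially decaying smooth coefficients, S°_k requiring in addition a_{ik1} = b_{ik1} = 0 for all i. Then there exists a sequence of functions V_k, k = 0, 1, 2, …, with V₀ as above, such that V_k − V₀ ∈ S_1, Ψ(V_k) ∈ S°_{k+1}, and V_k − V_{k−1} ∈ S_k for each k ≥ 1. -/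

import Mathlib

open Real

/-- A smooth function on `ℝ` all of whose derivatives decay faster than any
exponential: `|D^ℓ f(y)| ≤ C_{Nℓ} e^{-N|y|}` for all `N, ℓ`. -/
def ExpDecayAll (f : ℝ → ℝ) : Prop :=
  ContDiff ℝ (⊤ : ℕ∞) f ∧ ∀ N l : ℕ, ∃ C : ℝ, ∀ y : ℝ,
    |iteratedDeriv l f y| ≤ C * Real.exp (-(N : ℝ) * |y|)

/-- The class `S_k` of finite sums
`Σ (a_{ijn}(y) cos nφ + b_{ijn}(y) sin nφ) (ln^i ρ)/ρ^j`, `j ≥ k`, with smooth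
exponentially decaying coefficients. -/
def MemS (φ : ℝ → ℝ → ℝ) (k : ℕ) (S : ℝ → ℝ → ℝ) : Prop :=
  ∃ (N I J : ℕ) (A B : ℕ → ℕ → ℕ → ℝ → ℝ),
    (∀ i j n : ℕ, ExpDecayAll (A i j n) ∧ ExpDecayAll (B i j n)) ∧
    ∀ ρ y : ℝ, 0 < ρ → S ρ y =
      ∑ n ∈ Finset.range (N + 1), ∑ i ∈ Finset.range (I + 1), ∑ j ∈ Finset.Icc k J,
        (A i j n y * Real.cos (n * φ ρ y) + B i j n y * Real.sin (n * φ ρ y)) *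
          (Real.log ρ) ^ i / ρ ^ j

/-- The subclass `S°_k ⊆ S_k` with no resonant `n = 1` terms at the lowest power
`j = k`: `a_{ik1} = b_{ik1} = 0` for all `i`. -/
def MemS0 (φ : ℝ → ℝ → ℝ) (k : ℕ) (S : ℝ → ℝ → ℝ) : Prop :=
  ∃ (N I J : ℕ) (A B : ℕ → ℕ → ℕ → ℝ → ℝ),
    (∀ i j n : ℕ, ExpDecayAll (A i j n) ∧ ExpDecayAll (B i j n)) ∧
    (∀ i : ℕ, (∀ y : ℝ, A i k 1 y = 0) ∧ (∀ y : ℝ, B i k 1 y = 0)) ∧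
    ∀ ρ y : ℝ, 0 < ρ → S ρ y =
      ∑ n ∈ Finset.range (N + 1), ∑ i ∈ Finset.range (I + 1), ∑ j ∈ Finset.Icc k J,
        (A i j n y * Real.cos (n * φ ρ y) + B i j n y * Real.sin (n * φ ρ y)) *
          (Real.log ρ) ^ i / ρ ^ j

/-- The cubic Klein–Gordon operator in hyperbolic coordinates acting on
`V = ρ^{1/2}v`: `Ψ(V) = ∂_ρ²V + (1 + (β/ρ)V² + 1/(4ρ²))V − ρ^{-2}∂_y²V`. -/
noncomputable def Psi (β : ℝ) (V : ℝ → ℝ → ℝ) (ρ y : ℝ) : ℝ :=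
  deriv (deriv (fun r => V r y)) ρ
    + (1 + β / ρ * (V ρ y) ^ 2 + 1 / (4 * ρ ^ 2)) * V ρ y
    - 1 / ρ ^ 2 * deriv (deriv (fun z => V ρ z)) y

/-! ### Rapidly decaying coefficients -/

namespace ExpDecayAll

theorem zero : ExpDecayAll (fun _ => 0) := by
  refine ⟨contDiff_const, fun N l => ⟨0, fun y => ?_⟩⟩
  simp

theorem add {f g : ℝ → ℝ} (hf : ExpDecayAll f) (hg : ExpDecayAll g) :
    ExpDecayAll (fun y => f y + g y) := by
  refine ⟨hf.1.add hg.1, fun N l => ?_⟩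
  obtain ⟨C, hC⟩ := hf.2 N l
  obtain ⟨D, hD⟩ := hg.2 N l
  refine ⟨C + D, fun y => ?_⟩
  rw [iteratedDeriv_fun_add ((hf.1.of_le (by exact_mod_cast le_top)).contDiffAt)
    ((hg.1.of_le (by exact_mod_cast le_top)).contDiffAt), add_mul]
  exact (abs_add_le _ _).trans (add_le_add (hC y) (hD y))

theorem deriv {f : ℝ → ℝ} (hf : ExpDecayAll f) : ExpDecayAll (deriv f) := by
  refine ⟨(contDiff_infty_iff_deriv.1 hf.1).2, fun N l => ?_⟩
  simpa only [iteratedDeriv_succ'] using hf.2 N (l + 1)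

theorem differentiable {f : ℝ → ℝ} (hf : ExpDecayAll f) : Differentiable ℝ f :=
  (contDiff_infty_iff_deriv.1 hf.1).1

theorem hasDerivAt {f : ℝ → ℝ} (hf : ExpDecayAll f) (y : ℝ) :
    HasDerivAt f (_root_.deriv f y) y :=
  (hf.differentiable y).hasDerivAt

theorem mul {f g : ℝ → ℝ} (hf : ExpDecayAll f) (hg : ExpDecayAll g) :
    ExpDecayAll (fun y => f y * g y) := by
  refine ⟨hf.1.mul hg.1, fun N l => ?_⟩
  induction l generalizing f g with
  | zero =>
    obtain ⟨C, hC⟩ := hf.2 N 0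
    obtain ⟨D, hD⟩ := hg.2 0 0
    refine ⟨C * D, fun y => ?_⟩
    have h1 := hC y
    have h2 := hD y
    simp only [iteratedDeriv_zero, Nat.cast_zero, neg_zero, zero_mul, Real.exp_zero,
      mul_one] at h1 h2 ⊢
    rw [abs_mul, mul_right_comm]
    exact mul_le_mul h1 h2 (abs_nonneg _) ((abs_nonneg _).trans h1)
  | succ l ih =>
    obtain ⟨C, hC⟩ := ih hf.deriv hg
    obtain ⟨D, hD⟩ := ih hf hg.deriv
    refine ⟨C + D, fun y => ?_⟩
    have h : _root_.deriv (fun y => f y * g y)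
        = fun y => _root_.deriv f y * g y + f y * _root_.deriv g y := by
      funext y
      exact ((hf.hasDerivAt y).mul (hg.hasDerivAt y)).deriv
    rw [iteratedDeriv_succ', h, iteratedDeriv_fun_add
      (((hf.deriv.1.mul hg.1).of_le (by exact_mod_cast le_top)).contDiffAt)
      (((hf.1.mul hg.deriv.1).of_le (by exact_mod_cast le_top)).contDiffAt), add_mul]
    exact (abs_add_le _ _).trans (add_le_add (hC y) (hD y))

theorem const_mul {f : ℝ → ℝ} (r : ℝ) (hf : ExpDecayAll f) :
    ExpDecayAll (fun y => r * f y) := by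
  refine ⟨contDiff_const.mul hf.1, fun N l => ?_⟩
  obtain ⟨C, hC⟩ := hf.2 N l
  refine ⟨|r| * C, fun y => ?_⟩
  rw [iteratedDeriv_const_mul_field, abs_mul, mul_assoc]
  exact mul_le_mul_of_nonneg_left (hC y) (abs_nonneg r)

end ExpDecayAll

/-! ### Spans of trigonometric-logarithmic monomials -/

/-- The monomial `c(y) cos(nφ + θ) (ln^i ρ)/ρ^j`. -/
noncomputable def trigLog (φ : ℝ → ℝ → ℝ) (c : ℝ → ℝ) (n : ℤ) (θ : ℝ) (i j : ℕ) (ρ y : ℝ) : ℝ :=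
  c y * Real.cos (n * φ ρ y + θ) * Real.log ρ ^ i / ρ ^ j

/-- Functions agreeing on `ρ > 0` with a finite sum of monomials whose frequency `n` and power `j`
satisfy `P |n| j`. -/
inductive TrigLogSpan (φ : ℝ → ℝ → ℝ) (P : ℕ → ℕ → Prop) : (ℝ → ℝ → ℝ) → Prop
  | monomial (c : ℝ → ℝ) (n : ℤ) (θ : ℝ) (i j : ℕ) (hc : ExpDecayAll c) (hP : P n.natAbs j) :
      TrigLogSpan φ P (trigLog φ c n θ i j)
  | zero : TrigLogSpan φ P (fun _ _ => 0)
  | add (S T : ℝ → ℝ → ℝ) (hS : TrigLogSpan φ P S) (hT : TrigLogSpan φ P T) :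
      TrigLogSpan φ P (fun ρ y => S ρ y + T ρ y)
  | congr (S T : ℝ → ℝ → ℝ) (hS : TrigLogSpan φ P S)
      (h : ∀ ρ y : ℝ, 0 < ρ → T ρ y = S ρ y) : TrigLogSpan φ P T

/-- All terms have order at least `k` in `1/ρ`. -/
abbrev OrderSpan (φ : ℝ → ℝ → ℝ) (k : ℕ) : (ℝ → ℝ → ℝ) → Prop :=
  TrigLogSpan φ (fun _ j => k ≤ j)

/-- All terms have order at least `k` in `1/ρ`, and none of order `k` is resonant. -/
abbrev NonresSpan (φ : ℝ → ℝ → ℝ) (k : ℕ) : (ℝ → ℝ → ℝ) → Prop :=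
  TrigLogSpan φ (fun n j => k ≤ j ∧ (n = 1 → k < j))

namespace TrigLogSpan

variable {φ : ℝ → ℝ → ℝ} {P Q : ℕ → ℕ → Prop} {S T : ℝ → ℝ → ℝ}

theorem mono (hPQ : ∀ n j, P n j → Q n j) (hS : TrigLogSpan φ P S) : TrigLogSpan φ Q S := by
  induction hS with
  | monomial c n θ i j hc hP => exact .monomial c n θ i j hc (hPQ _ _ hP)
  | zero => exact .zero
  | add S T _ _ hS hT => exact .add S T hS hT
  | congr S T _ h hS => exact .congr S T hS h

theorem const_mul (r : ℝ) (hS : TrigLogSpan φ P S) :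
    TrigLogSpan φ P (fun ρ y => r * S ρ y) := by
  induction hS with
  | monomial c n θ i j hc hP =>
    refine .congr _ _ (.monomial _ n θ i j (hc.const_mul r) hP) fun ρ y _ => ?_
    simp only [trigLog]
    ring
  | zero => exact .congr _ _ .zero fun ρ y _ => by ring
  | add S T _ _ hS hT => exact .congr _ _ (.add _ _ hS hT) fun ρ y _ => by ring
  | congr S T _ h hS => exact .congr _ _ hS fun ρ y hρ => by rw [h ρ y hρ]

theorem sub (hS : TrigLogSpan φ P S) (hT : TrigLogSpan φ P T) :
    TrigLogSpan φ P (fun ρ y => S ρ y - T ρ y) :=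
  .congr _ _ (.add _ _ hS (hT.const_mul (-1))) fun ρ y _ => by ring

theorem split (R : ℕ → ℕ → Prop) (h : ∀ n j, P n j → Q n j ∨ R n j) (hS : TrigLogSpan φ P S) :
    ∃ S₁ S₂, TrigLogSpan φ Q S₁ ∧ TrigLogSpan φ R S₂ ∧
      ∀ ρ y : ℝ, 0 < ρ → S ρ y = S₁ ρ y + S₂ ρ y := by
  induction hS with
  | monomial c n θ i j hc hP =>
    rcases h _ _ hP with hQ | hR
    · exact ⟨_, _, .monomial c n θ i j hc hQ, .zero, fun ρ y _ => by ring⟩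
    · exact ⟨_, _, .zero, .monomial c n θ i j hc hR, fun ρ y _ => by ring⟩
  | zero => exact ⟨_, _, .zero, .zero, fun ρ y _ => by ring⟩
  | add S T _ _ hS hT =>
    obtain ⟨S₁, S₂, h₁, h₂, hS⟩ := hS
    obtain ⟨T₁, T₂, k₁, k₂, hT⟩ := hT
    exact ⟨_, _, .add _ _ h₁ k₁, .add _ _ h₂ k₂, fun ρ y hρ => by
      simp only [hS ρ y hρ, hT ρ y hρ]; ring⟩
  | congr S T _ h' hS =>
    obtain ⟨S₁, S₂, h₁, h₂, hS⟩ := hS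
    exact ⟨S₁, S₂, h₁, h₂, fun ρ y hρ => by rw [h' ρ y hρ, hS ρ y hρ]⟩

theorem div_pow {k : ℕ} (m : ℕ) (hS : OrderSpan φ k S) :
    OrderSpan φ (k + m) (fun ρ y => S ρ y / ρ ^ m) := by
  induction hS with
  | monomial c n θ i j hc hP =>
    refine .congr _ _ (.monomial c n θ i (j + m) hc (by omega)) fun ρ y hρ => ?_
    simp only [trigLog]
    rw [pow_add, div_div]
  | zero => exact .congr _ _ .zero fun ρ y _ => by ring
  | add S T _ _ hS hT => exact .congr _ _ (.add _ _ hS hT) fun ρ y _ => by ring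
  | congr S T _ h hS => exact .congr _ _ hS fun ρ y hρ => by rw [h ρ y hρ]

theorem mul {k l : ℕ} (hS : OrderSpan φ k S) (hT : OrderSpan φ l T) :
    OrderSpan φ (k + l) (fun ρ y => S ρ y * T ρ y) := by
  induction hS with
  | monomial c n θ i j hc hP =>
    induction hT with
    | monomial d m η i' j' hd hQ =>
      refine .congr _ _ (.add _ _
        (.monomial _ (n + m) (θ + η) (i + i') (j + j') ((hc.mul hd).const_mul (1 / 2)) (by omega))
        (.monomial _ (n - m) (θ - η) (i + i') (j + j') ((hc.mul hd).const_mul (1 / 2)) (by omega)))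
        fun ρ y hρ => ?_
      simp only [trigLog]
      push_cast
      rw [show ((n : ℝ) + m) * φ ρ y + (θ + η) = (n * φ ρ y + θ) + (m * φ ρ y + η) by ring,
        show ((n : ℝ) - m) * φ ρ y + (θ - η) = (n * φ ρ y + θ) - (m * φ ρ y + η) by ring]
      generalize n * φ ρ y + θ = x
      generalize m * φ ρ y + η = z
      rw [Real.cos_add, Real.cos_sub]
      field_simp
      ring
    | zero => exact .congr _ _ .zero fun ρ y _ => by ring
    | add S T _ _ hS hT => exact .congr _ _ (.add _ _ hS hT) fun ρ y _ => by ring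
    | congr S T _ h hS => exact .congr _ _ hS fun ρ y hρ => by rw [h ρ y hρ]
  | zero => exact .congr _ _ .zero fun ρ y _ => by ring
  | add S T _ _ hS hT => exact .congr _ _ (.add _ _ hS hT) fun ρ y _ => by ring
  | congr S T _ h hS => exact .congr _ _ hS fun ρ y hρ => by rw [h ρ y hρ]

theorem exists_coeff (hS : TrigLogSpan φ P S) :
    ∃ (M : ℕ) (A B : ℕ → ℕ → ℕ → ℝ → ℝ),
      (∀ i j n, ExpDecayAll (A i j n) ∧ ExpDecayAll (B i j n)) ∧
      (∀ i j n, ¬ P n j → ∀ y, A i j n y = 0 ∧ B i j n y = 0) ∧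
      ∀ K, M ≤ K → ∀ ρ y : ℝ, 0 < ρ → S ρ y =
        ∑ n ∈ Finset.range (K + 1), ∑ i ∈ Finset.range (K + 1), ∑ j ∈ Finset.range (K + 1),
          (A i j n y * Real.cos (n * φ ρ y) + B i j n y * Real.sin (n * φ ρ y)) *
            (Real.log ρ) ^ i / ρ ^ j := by
  induction hS with
  | monomial c n θ i j hc hP =>
    obtain ⟨η, hη⟩ : ∃ η : ℝ, ∀ x : ℝ, Real.cos (n * x + θ) = Real.cos (n.natAbs * x + η) := by
      rcases Int.natAbs_eq n with h | h
      · exact ⟨θ, fun x => by rw [h]; simp⟩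
      · refine ⟨-θ, fun x => ?_⟩
        rw [← Real.cos_neg]
        congr 1
        have : (n : ℝ) = -(n.natAbs : ℝ) := by exact_mod_cast h
        rw [this]; ring
    refine ⟨max n.natAbs (max i j),
      fun i' j' n' y => if i' = i ∧ j' = j ∧ n' = n.natAbs then Real.cos η * c y else 0,
      fun i' j' n' y => if i' = i ∧ j' = j ∧ n' = n.natAbs then -Real.sin η * c y else 0,
      fun i' j' n' => ?_, fun i' j' n' hn y => ?_, fun K hK ρ y hρ => ?_⟩
    · by_cases h : i' = i ∧ j' = j ∧ n' = n.natAbs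
      · simp only [h, and_self, if_true]
        exact ⟨hc.const_mul _, hc.const_mul _⟩
      · simp only [h, if_false]
        exact ⟨.zero, .zero⟩
    · have h : ¬ (i' = i ∧ j' = j ∧ n' = n.natAbs) := by
        rintro ⟨-, rfl, rfl⟩
        exact hn hP
      simp only [h, if_false, and_self]
    · rw [Finset.sum_eq_single_of_mem n.natAbs (by simp; omega),
        Finset.sum_eq_single_of_mem i (by simp; omega),
        Finset.sum_eq_single_of_mem j (by simp; omega)]
      · simp only [trigLog, and_self, if_true, hη, Real.cos_add]
        ring
      · intro j' _ h
        simp [h]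
      · intro i' _ h
        simp [h]
      · intro n' _ h
        simp [h]
  | zero => exact ⟨0, fun _ _ _ _ => 0, fun _ _ _ _ => 0, fun _ _ _ => ⟨.zero, .zero⟩,
      fun _ _ _ _ _ => ⟨rfl, rfl⟩, fun _ _ _ _ _ => by simp⟩
  | add S T _ _ hS hT =>
    obtain ⟨M, A, B, h₁, h₂, h₃⟩ := hS
    obtain ⟨M', A', B', k₁, k₂, k₃⟩ := hT
    refine ⟨max M M', fun i j n y => A i j n y + A' i j n y, fun i j n y => B i j n y + B' i j n y,
      fun i j n => ⟨(h₁ i j n).1.add (k₁ i j n).1, (h₁ i j n).2.add (k₁ i j n).2⟩,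
      fun i j n hn y => ?_, fun K hK ρ y hρ => ?_⟩
    · simp [h₂ i j n hn y, k₂ i j n hn y]
    · simp only [h₃ K (by omega) ρ y hρ, k₃ K (by omega) ρ y hρ, ← Finset.sum_add_distrib]
      refine Finset.sum_congr rfl fun n _ => Finset.sum_congr rfl fun i _ =>
        Finset.sum_congr rfl fun j _ => ?_
      ring
  | congr S T _ h hS =>
    obtain ⟨M, A, B, h₁, h₂, h₃⟩ := hS
    exact ⟨M, A, B, h₁, h₂, fun K hK ρ y hρ => by rw [h ρ y hρ, h₃ K hK ρ y hρ]⟩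

theorem exists_coeff_Icc {k : ℕ} (hP : ∀ n j, P n j → k ≤ j) (hS : TrigLogSpan φ P S) :
    ∃ (M : ℕ) (A B : ℕ → ℕ → ℕ → ℝ → ℝ),
      (∀ i j n, ExpDecayAll (A i j n) ∧ ExpDecayAll (B i j n)) ∧
      (∀ i j n, ¬ P n j → ∀ y, A i j n y = 0 ∧ B i j n y = 0) ∧
      ∀ ρ y : ℝ, 0 < ρ → S ρ y =
        ∑ n ∈ Finset.range (M + 1), ∑ i ∈ Finset.range (M + 1), ∑ j ∈ Finset.Icc k M,
          (A i j n y * Real.cos (n * φ ρ y) + B i j n y * Real.sin (n * φ ρ y)) *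
            (Real.log ρ) ^ i / ρ ^ j := by
  obtain ⟨M, A, B, h₁, h₂, h₃⟩ := hS.exists_coeff
  refine ⟨M, A, B, h₁, h₂, fun ρ y hρ => ?_⟩
  rw [h₃ M le_rfl ρ y hρ]
  refine Finset.sum_congr rfl fun n _ => Finset.sum_congr rfl fun i _ => ?_
  refine (Finset.sum_subset (fun j hj => ?_) fun j hj hj' => ?_).symm
  · simp only [Finset.mem_Icc, Finset.mem_range] at hj ⊢
    omega
  · simp only [Finset.mem_Icc, Finset.mem_range] at hj hj'
    have := h₂ i j n (fun h => hj' ⟨hP n j h, by omega⟩) y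
    simp [this]

theorem memS {k : ℕ} (hS : OrderSpan φ k S) : MemS φ k S := by
  obtain ⟨M, A, B, h₁, -, h₃⟩ := hS.exists_coeff_Icc fun _ _ h => h
  exact ⟨M, M, M, A, B, h₁, h₃⟩

theorem memS0 {k : ℕ} (hS : NonresSpan φ k S) : MemS0 φ k S := by
  obtain ⟨M, A, B, h₁, h₂, h₃⟩ := hS.exists_coeff_Icc fun _ _ h => h.1
  have h (i : ℕ) := h₂ i k 1 (fun h => (h.2 rfl).false)
  exact ⟨M, M, M, A, B, h₁, fun i => ⟨fun y => (h i y).1, fun y => (h i y).2⟩, h₃⟩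

end TrigLogSpan

/-! ### Differentiation of monomials -/

section Phase

variable {φ : ℝ → ℝ → ℝ} {δ b₁ : ℝ → ℝ} {b₀ : ℝ}

/-- The part of `∂_ρ trigLog φ c n θ i j` of order `j + 1` in `1/ρ`. -/
noncomputable def trigLogRem (φ : ℝ → ℝ → ℝ) (δ c : ℝ → ℝ) (n : ℤ) (θ : ℝ) (i j : ℕ)
    (ρ y : ℝ) : ℝ :=
  n * trigLog φ (fun y => δ y * c y) n (θ + π / 2) i (j + 1) ρ y
    + i * trigLog φ c n θ (i - 1) (j + 1) ρ y - j * trigLog φ c n θ i (j + 1) ρ y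

theorem orderSpan_trigLog {c : ℝ → ℝ} (hc : ExpDecayAll c) (n : ℤ) (θ : ℝ) (i : ℕ) {j k : ℕ}
    (h : k ≤ j) : OrderSpan φ k (trigLog φ c n θ i j) :=
  .monomial c n θ i j hc h

theorem orderSpan_trigLogRem {c : ℝ → ℝ} (hδ : ExpDecayAll δ) (hc : ExpDecayAll c) (n : ℤ) (θ : ℝ)
    (i : ℕ) {j k : ℕ} (h : k ≤ j + 1) : OrderSpan φ k (trigLogRem φ δ c n θ i j) :=
  .sub (.add _ _ (.const_mul _ (orderSpan_trigLog (hδ.mul hc) _ _ _ h))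
    (.const_mul _ (orderSpan_trigLog hc _ _ _ h))) (.const_mul _ (orderSpan_trigLog hc _ _ _ h))

theorem hasDerivAt_inv_pow {ρ : ℝ} (hρ : 0 < ρ) (j : ℕ) :
    HasDerivAt (fun r : ℝ => (r ^ j)⁻¹) (-j / ρ ^ (j + 1)) ρ := by
  refine ((hasDerivAt_pow j ρ).inv (pow_pos hρ j).ne').congr_deriv ?_
  cases j with
  | zero => simp
  | succ j =>
    simp only [Nat.add_sub_cancel]
    field_simp
    ring

theorem hasDerivAt_trigLog_fst
    (hφ : ∀ ρ y, φ ρ y = ρ + δ y * Real.log ρ + (b₀ + b₁ y))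
    (c : ℝ → ℝ) (n : ℤ) (θ : ℝ) (i j : ℕ) {ρ : ℝ} (hρ : 0 < ρ) (y : ℝ) :
    HasDerivAt (fun r => trigLog φ c n θ i j r y)
      (n * trigLog φ c n (θ + π / 2) i j ρ y + trigLogRem φ δ c n θ i j ρ y) ρ := by
  have hlog := Real.hasDerivAt_log hρ.ne'
  have h1 : HasDerivAt (fun r => φ r y) (1 + δ y * ρ⁻¹) ρ := by
    simp only [hφ]
    exact ((hasDerivAt_id' ρ).add (hlog.const_mul (δ y))).add_const _
  have h2 := ((((h1.const_mul (n : ℝ)).add_const θ).cos.const_mul (c y)).mul (hlog.pow i)).mul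
    (hasDerivAt_inv_pow hρ j)
  refine (h2.congr_deriv ?_).congr_of_eventuallyEq (.of_forall fun r => ?_)
  · simp only [trigLogRem, trigLog, ← add_assoc, Real.cos_add_pi_div_two, Pi.mul_apply,
      Pi.pow_apply]
    field_simp
    ring
  · simp only [trigLog, Pi.mul_apply, Pi.pow_apply, div_eq_mul_inv]

theorem hasDerivAt_trigLog_snd
    (hφ : ∀ ρ y, φ ρ y = ρ + δ y * Real.log ρ + (b₀ + b₁ y))
    (hδ : Differentiable ℝ δ) (hb₁ : Differentiable ℝ b₁)
    {c : ℝ → ℝ} (hc : Differentiable ℝ c) (n : ℤ) (θ : ℝ) (i j : ℕ) (ρ y : ℝ) :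
    HasDerivAt (fun z => trigLog φ c n θ i j ρ z)
      (trigLog φ (deriv c) n θ i j ρ y
        + n * trigLog φ (fun y => deriv δ y * c y) n (θ + π / 2) (i + 1) j ρ y
        + n * trigLog φ (fun y => deriv b₁ y * c y) n (θ + π / 2) i j ρ y) y := by
  have h1 : HasDerivAt (fun z => φ ρ z) (deriv δ y * Real.log ρ + deriv b₁ y) y := by
    simp only [hφ]
    exact (((hδ y).hasDerivAt.mul_const _).const_add ρ).add ((hb₁ y).hasDerivAt.const_add b₀)
  have h2 := (((hc y).hasDerivAt.mul ((h1.const_mul (n : ℝ)).add_const θ).cos).mul_const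
    (Real.log ρ ^ i)).div_const (ρ ^ j)
  refine h2.congr_deriv ?_
  simp only [trigLog, ← add_assoc, Real.cos_add_pi_div_two]
  ring

variable {k : ℕ} {S T : ℝ → ℝ → ℝ}

theorem OrderSpan.exists_hasDerivAt_fst
    (hφ : ∀ ρ y, φ ρ y = ρ + δ y * Real.log ρ + (b₀ + b₁ y)) (hδ : ExpDecayAll δ)
    (hS : OrderSpan φ k S) : ∃ S', OrderSpan φ k S' ∧
      ∀ ρ y, 0 < ρ → HasDerivAt (fun r => S r y) (S' ρ y) ρ := by
  induction hS with
  | monomial c n θ i j hc hP =>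
    exact ⟨_, .add _ _ (.const_mul _ (orderSpan_trigLog hc _ _ _ hP))
      (orderSpan_trigLogRem hδ hc _ _ _ (by omega)),
      fun ρ y hρ => hasDerivAt_trigLog_fst hφ c n θ i j hρ y⟩
  | zero => exact ⟨_, .zero, fun ρ y _ => hasDerivAt_const _ _⟩
  | add S T _ _ hS hT =>
    obtain ⟨S', h₁, h₂⟩ := hS
    obtain ⟨T', k₁, k₂⟩ := hT
    exact ⟨_, .add _ _ h₁ k₁, fun ρ y hρ => (h₂ ρ y hρ).add (k₂ ρ y hρ)⟩
  | congr S T _ h hS =>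
    obtain ⟨S', h₁, h₂⟩ := hS
    exact ⟨S', h₁, fun ρ y hρ => (h₂ ρ y hρ).congr_of_eventuallyEq <|
      (lt_mem_nhds hρ).mono fun r hr => h r y hr⟩

theorem OrderSpan.exists_hasDerivAt_snd
    (hφ : ∀ ρ y, φ ρ y = ρ + δ y * Real.log ρ + (b₀ + b₁ y)) (hδ : ExpDecayAll δ)
    (hb₁ : ExpDecayAll b₁) (hS : OrderSpan φ k S) : ∃ S', OrderSpan φ k S' ∧
      ∀ ρ y, 0 < ρ → HasDerivAt (fun z => S ρ z) (S' ρ y) y := by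
  induction hS with
  | monomial c n θ i j hc hP =>
    exact ⟨_, .add _ _ (.add _ _ (orderSpan_trigLog hc.deriv _ _ _ hP)
      (.const_mul _ (orderSpan_trigLog (hδ.deriv.mul hc) _ _ _ hP)))
      (.const_mul _ (orderSpan_trigLog (hb₁.deriv.mul hc) _ _ _ hP)),
      fun ρ y hρ => hasDerivAt_trigLog_snd hφ hδ.differentiable hb₁.differentiable
        hc.differentiable n θ i j ρ y⟩
  | zero => exact ⟨_, .zero, fun ρ y _ => hasDerivAt_const _ _⟩
  | add S T _ _ hS hT =>
    obtain ⟨S', h₁, h₂⟩ := hS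
    obtain ⟨T', k₁, k₂⟩ := hT
    exact ⟨_, .add _ _ h₁ k₁, fun ρ y hρ => (h₂ ρ y hρ).add (k₂ ρ y hρ)⟩
  | congr S T _ h hS =>
    obtain ⟨S', h₁, h₂⟩ := hS
    exact ⟨S', h₁, fun ρ y hρ => (h₂ ρ y hρ).congr_of_eventuallyEq <|
      .of_forall fun z => h ρ z hρ⟩

/-! ### The leading oscillation operator -/

/-- The harmonic oscillator `∂_ρ² + 1`. -/
noncomputable def oscOp (S : ℝ → ℝ → ℝ) (ρ y : ℝ) : ℝ :=
  deriv (deriv (fun r => S r y)) ρ + S ρ y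

theorem deriv_deriv_eq_of_pos {f f' : ℝ → ℝ} {f'' ρ : ℝ} (hρ : 0 < ρ)
    (h : ∀ r, 0 < r → HasDerivAt f (f' r) r) (h' : HasDerivAt f' f'' ρ) :
    deriv (deriv f) ρ = f'' :=
  (h'.congr_of_eventuallyEq <| (lt_mem_nhds hρ).mono fun r hr => (h r hr).deriv).deriv

theorem oscOp_add
    (hφ : ∀ ρ y, φ ρ y = ρ + δ y * Real.log ρ + (b₀ + b₁ y)) (hδ : ExpDecayAll δ) {l : ℕ}
    (hS : OrderSpan φ k S) (hT : OrderSpan φ l T) {ρ : ℝ} (hρ : 0 < ρ) (y : ℝ) :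
    oscOp (fun ρ y => S ρ y + T ρ y) ρ y = oscOp S ρ y + oscOp T ρ y := by
  obtain ⟨S₁, h₁, hd₁⟩ := OrderSpan.exists_hasDerivAt_fst hφ hδ hS
  obtain ⟨S₂, h₂, hd₂⟩ := OrderSpan.exists_hasDerivAt_fst hφ hδ h₁
  obtain ⟨T₁, k₁, kd₁⟩ := OrderSpan.exists_hasDerivAt_fst hφ hδ hT
  obtain ⟨T₂, k₂, kd₂⟩ := OrderSpan.exists_hasDerivAt_fst hφ hδ k₁
  rw [oscOp, oscOp, oscOp, deriv_deriv_eq_of_pos hρ (fun r hr => hd₁ r y hr) (hd₂ ρ y hρ),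
    deriv_deriv_eq_of_pos hρ (fun r hr => kd₁ r y hr) (kd₂ ρ y hρ),
    deriv_deriv_eq_of_pos hρ (fun r hr => (hd₁ r y hr).fun_add (kd₁ r y hr))
      ((hd₂ ρ y hρ).fun_add (kd₂ ρ y hρ))]
  ring

theorem deriv_deriv_snd_add
    (hφ : ∀ ρ y, φ ρ y = ρ + δ y * Real.log ρ + (b₀ + b₁ y)) (hδ : ExpDecayAll δ)
    (hb₁ : ExpDecayAll b₁) {l : ℕ}
    (hS : OrderSpan φ k S) (hT : OrderSpan φ l T) {ρ : ℝ} (hρ : 0 < ρ) (y : ℝ) :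
    deriv (deriv (fun z => S ρ z + T ρ z)) y
      = deriv (deriv (fun z => S ρ z)) y + deriv (deriv (fun z => T ρ z)) y := by
  obtain ⟨S₁, h₁, hd₁⟩ := OrderSpan.exists_hasDerivAt_snd hφ hδ hb₁ hS
  obtain ⟨S₂, -, hd₂⟩ := OrderSpan.exists_hasDerivAt_snd hφ hδ hb₁ h₁
  obtain ⟨T₁, k₁, kd₁⟩ := OrderSpan.exists_hasDerivAt_snd hφ hδ hb₁ hT
  obtain ⟨T₂, -, kd₂⟩ := OrderSpan.exists_hasDerivAt_snd hφ hδ hb₁ k₁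
  have e₁ : deriv (fun z => S ρ z) = fun z => S₁ ρ z := funext fun z => (hd₁ ρ z hρ).deriv
  have e₂ : deriv (fun z => T ρ z) = fun z => T₁ ρ z := funext fun z => (kd₁ ρ z hρ).deriv
  have e₃ : deriv (fun z => S ρ z + T ρ z) = fun z => S₁ ρ z + T₁ ρ z :=
    funext fun z => ((hd₁ ρ z hρ).fun_add (kd₁ ρ z hρ)).deriv
  rw [e₁, e₂, e₃, (hd₂ ρ y hρ).deriv, (kd₂ ρ y hρ).deriv,
    ((hd₂ ρ y hρ).fun_add (kd₂ ρ y hρ)).deriv]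

theorem orderSpan_deriv_deriv_snd
    (hφ : ∀ ρ y, φ ρ y = ρ + δ y * Real.log ρ + (b₀ + b₁ y)) (hδ : ExpDecayAll δ)
    (hb₁ : ExpDecayAll b₁) (hS : OrderSpan φ k S) :
    OrderSpan φ k (fun ρ y => deriv (deriv (fun z => S ρ z)) y) := by
  obtain ⟨S₁, h₁, hd₁⟩ := OrderSpan.exists_hasDerivAt_snd hφ hδ hb₁ hS
  obtain ⟨S₂, h₂, hd₂⟩ := OrderSpan.exists_hasDerivAt_snd hφ hδ hb₁ h₁
  refine .congr _ _ h₂ fun ρ y hρ => ?_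
  have e₁ : deriv (fun z => S ρ z) = fun z => S₁ ρ z := funext fun z => (hd₁ ρ z hρ).deriv
  rw [e₁, (hd₂ ρ y hρ).deriv]

/-- The two leading orders of `(∂_ρ² + 1)` applied to a monomial. -/
theorem oscOp_trigLog
    (hφ : ∀ ρ y, φ ρ y = ρ + δ y * Real.log ρ + (b₀ + b₁ y)) (hδ : ExpDecayAll δ)
    {c : ℝ → ℝ} (hc : ExpDecayAll c) (n : ℤ) (θ : ℝ) (i j : ℕ) :
    OrderSpan φ (j + 2) (fun ρ y => oscOp (trigLog φ c n θ i j) ρ y -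
      ((1 - (n : ℝ) ^ 2) * trigLog φ c n θ i j ρ y
        - 2 * (n : ℝ) ^ 2 * trigLog φ (fun y => δ y * c y) n θ i (j + 1) ρ y
        - 2 * n * i * trigLog φ c n (θ - π / 2) (i - 1) (j + 1) ρ y
        + 2 * n * j * trigLog φ c n (θ - π / 2) i (j + 1) ρ y)) := by
  refine .congr _ _ (.sub (.add _ _
    (.const_mul n (orderSpan_trigLogRem hδ (hδ.mul hc) n (θ + π / 2) i (j := j + 1) le_rfl))
    (.const_mul i (orderSpan_trigLogRem hδ hc n θ (i - 1) (j := j + 1) le_rfl)))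
    (.const_mul j (orderSpan_trigLogRem hδ hc n θ i (j := j + 1) le_rfl))) fun ρ y hρ => ?_
  have hd (c : ℝ → ℝ) (θ : ℝ) (i j : ℕ) := hasDerivAt_trigLog_fst hφ c n θ i j hρ y
  have h₂ := ((hd c (θ + π / 2) i j).const_mul (n : ℝ)).add
    ((((hd (fun y => δ y * c y) (θ + π / 2) i (j + 1)).const_mul (n : ℝ)).add
      ((hd c θ (i - 1) (j + 1)).const_mul (i : ℝ))).sub
      ((hd c θ i (j + 1)).const_mul (j : ℝ)))
  rw [oscOp, deriv_deriv_eq_of_pos hρ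
    (fun r hr => hasDerivAt_trigLog_fst hφ c n θ i j hr y) h₂]
  have e₁ (c : ℝ → ℝ) (i j : ℕ) :
      trigLog φ c n (θ + π / 2 + π / 2) i j ρ y = -trigLog φ c n θ i j ρ y := by
    simp only [trigLog, ← add_assoc, Real.cos_add_pi_div_two, Real.sin_add_pi_div_two]
    ring
  have e₂ (c : ℝ → ℝ) (i j : ℕ) :
      trigLog φ c n (θ - π / 2) i j ρ y = -trigLog φ c n (θ + π / 2) i j ρ y := by
    simp only [trigLog, ← add_assoc, ← add_sub_assoc, Real.cos_add_pi_div_two,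
      Real.cos_sub_pi_div_two]
    ring
  have e₃ : trigLogRem φ δ c n (θ + π / 2) i j ρ y
      = -(n * trigLog φ (fun y => δ y * c y) n θ i (j + 1) ρ y)
        + i * trigLog φ c n (θ + π / 2) (i - 1) (j + 1) ρ y
        - j * trigLog φ c n (θ + π / 2) i (j + 1) ρ y := by
    rw [trigLogRem, e₁]
    ring
  simp only [e₁, e₂, e₃]
  ring

/-! ### Removing the leading terms of an error -/

theorem OrderSpan.of_le {k l : ℕ} (h : k ≤ l) (hS : OrderSpan φ l S) : OrderSpan φ k S :=
  hS.mono fun _ _ h' => h.trans h'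

theorem OrderSpan.nonresSpan {k l : ℕ} (h : k < l) (hS : OrderSpan φ l S) : NonresSpan φ k S :=
  hS.mono fun _ _ h' => ⟨by omega, fun _ => by omega⟩

/-- Nonresonant terms of order `k` are inverted by the harmonic oscillator modulo order `k + 1`. -/
theorem exists_oscOp_add_orderSpan
    (hφ : ∀ ρ y, φ ρ y = ρ + δ y * Real.log ρ + (b₀ + b₁ y)) (hδ : ExpDecayAll δ)
    (hS : TrigLogSpan φ (fun n j => j = k ∧ n ≠ 1) S) :
    ∃ W, OrderSpan φ k W ∧ OrderSpan φ (k + 1) (fun ρ y => oscOp W ρ y + S ρ y) := by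
  induction hS with
  | monomial c n θ i j hc hP =>
    obtain ⟨rfl, hn⟩ := hP
    have hn' : (1 - (n : ℝ) ^ 2) ≠ 0 := by
      intro h
      have h' : n * n = 1 := by
        have : (n : ℝ) * n = 1 := by linarith
        exact_mod_cast this
      rcases mul_self_eq_one_iff.1 h' with h | h <;> simp [h] at hn
    have hd := hc.const_mul (-(1 - (n : ℝ) ^ 2)⁻¹)
    refine ⟨_, orderSpan_trigLog hd n θ i le_rfl, ?_⟩
    refine .congr _ _ (.add _ _ ((oscOp_trigLog hφ hδ hd n θ i j).of_le (by omega))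
      (.add _ _ (.sub (.const_mul (2 * n * j) (orderSpan_trigLog hd n (θ - π / 2) i le_rfl))
      (.const_mul (2 * n * i) (orderSpan_trigLog hd n (θ - π / 2) (i - 1) le_rfl)))
      (.const_mul (-(2 * n ^ 2)) (orderSpan_trigLog (hδ.mul hd) n θ i le_rfl)))) fun ρ y hρ => ?_
    have e : (1 - (n : ℝ) ^ 2) *
        trigLog φ (fun y => -(1 - (n : ℝ) ^ 2)⁻¹ * c y) n θ i j ρ y
          = -trigLog φ c n θ i j ρ y := by
      simp only [trigLog]
      field_simp
    linear_combination e
  | zero => exact ⟨_, .zero, .congr _ _ .zero fun ρ y _ => by simp [oscOp]⟩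
  | add S T _ _ hS hT =>
    obtain ⟨W, h₁, h₂⟩ := hS
    obtain ⟨X, k₁, k₂⟩ := hT
    refine ⟨_, .add _ _ h₁ k₁, .congr _ _ (.add _ _ h₂ k₂) fun ρ y hρ => ?_⟩
    rw [oscOp_add hφ hδ h₁ k₁ hρ]
    ring
  | congr S T _ h hS =>
    obtain ⟨W, h₁, h₂⟩ := hS
    exact ⟨W, h₁, .congr _ _ h₂ fun ρ y hρ => by rw [h ρ y hρ]⟩

/-- The linearized operator `∂_ρ² + 1 + (3β/ρ) a² cos² φ` up to lower order terms. -/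
noncomputable def resOp (β : ℝ) (a : ℝ → ℝ) (φ S : ℝ → ℝ → ℝ) (ρ y : ℝ) : ℝ :=
  oscOp S ρ y + 3 * β / ρ * (a y * Real.cos (φ ρ y)) ^ 2 * S ρ y

variable {β : ℝ} {a : ℝ → ℝ}

theorem resOp_add
    (hφ : ∀ ρ y, φ ρ y = ρ + δ y * Real.log ρ + (b₀ + b₁ y)) (hδ : ExpDecayAll δ) {l : ℕ}
    (hS : OrderSpan φ k S) (hT : OrderSpan φ l T) {ρ : ℝ} (hρ : 0 < ρ) (y : ℝ) :
    resOp β a φ (fun ρ y => S ρ y + T ρ y) ρ y = resOp β a φ S ρ y + resOp β a φ T ρ y := by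
  simp only [resOp, oscOp_add hφ hδ hS hT hρ]
  ring

/-- The resonant part of the linearized operator on a resonant monomial. -/
theorem resOp_trigLog
    (hφ : ∀ ρ y, φ ρ y = ρ + δ y * Real.log ρ + (b₀ + b₁ y)) (hδ : ExpDecayAll δ)
    (ha : ExpDecayAll a) (hδa : ∀ y, δ y = (3 / 8) * β * (a y) ^ 2)
    {c : ℝ → ℝ} (hc : ExpDecayAll c) (θ : ℝ) (i k : ℕ) :
    NonresSpan φ (k + 1) (fun ρ y => resOp β a φ (trigLog φ c 1 θ i k) ρ y -
      (3 / 2 * β * Real.cos θ * trigLog φ (fun y => a y * a y * c y) 1 0 i (k + 1) ρ y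
        - 2 * i * trigLog φ c 1 (θ - π / 2) (i - 1) (k + 1) ρ y
        + 2 * k * trigLog φ c 1 (θ - π / 2) i (k + 1) ρ y)) := by
  refine .congr _ _ (.add _ _
    ((oscOp_trigLog hφ hδ hc 1 θ i k).nonresSpan (by omega))
    (.const_mul (3 / 4 * β) (.monomial _ 3 θ i (k + 1) ((ha.mul ha).mul hc) (by simp))))
    fun ρ y hρ => ?_
  simp only [resOp, trigLog, Int.cast_one, one_mul, hδa, Int.cast_ofNat, add_zero]
  have e : Real.cos (3 * φ ρ y + θ) = 4 * Real.cos (φ ρ y) ^ 2 * Real.cos (φ ρ y + θ)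
      - Real.cos (φ ρ y + θ) - 2 * Real.cos θ * Real.cos (φ ρ y) := by
    rw [Real.cos_add, Real.cos_add, Real.cos_three_mul, Real.sin_three_mul]
    linear_combination 4 * Real.sin θ * Real.sin (φ ρ y) * Real.sin_sq_add_cos_sq (φ ρ y)
  rw [e]
  field_simp
  ring

/-- `F` can be removed by the linearized operator modulo nonresonant terms. -/
def Removable (β : ℝ) (a : ℝ → ℝ) (φ : ℝ → ℝ → ℝ) (k : ℕ) (F : ℝ → ℝ → ℝ) : Prop :=
  ∃ W, OrderSpan φ k W ∧ NonresSpan φ (k + 1) (fun ρ y => resOp β a φ W ρ y + F ρ y)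

namespace Removable

theorem of_nonresSpan (hF : NonresSpan φ (k + 1) S) : Removable β a φ k S :=
  ⟨_, .zero, .congr _ _ hF fun ρ y _ => by simp [resOp, oscOp]⟩

theorem add
    (hφ : ∀ ρ y, φ ρ y = ρ + δ y * Real.log ρ + (b₀ + b₁ y)) (hδ : ExpDecayAll δ)
    (hS : Removable β a φ k S) (hT : Removable β a φ k T) :
    Removable β a φ k (fun ρ y => S ρ y + T ρ y) := by
  obtain ⟨W, h₁, h₂⟩ := hS
  obtain ⟨X, k₁, k₂⟩ := hT
  refine ⟨_, .add _ _ h₁ k₁, .congr _ _ (.add _ _ h₂ k₂) fun ρ y hρ => ?_⟩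
  rw [resOp_add hφ hδ h₁ k₁ hρ]
  ring

theorem congr (hS : Removable β a φ k S) (h : ∀ ρ y : ℝ, 0 < ρ → T ρ y = S ρ y) :
    Removable β a φ k T := by
  obtain ⟨W, h₁, h₂⟩ := hS
  exact ⟨W, h₁, .congr _ _ h₂ fun ρ y hρ => by rw [h ρ y hρ]⟩

theorem of_resOp_add
    (hφ : ∀ ρ y, φ ρ y = ρ + δ y * Real.log ρ + (b₀ + b₁ y)) (hδ : ExpDecayAll δ)
    {W : ℝ → ℝ → ℝ} (hW : OrderSpan φ k W)
    (h : Removable β a φ k (fun ρ y => resOp β a φ W ρ y + S ρ y)) :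
    Removable β a φ k S := by
  obtain ⟨X, h₁, h₂⟩ := h
  refine ⟨_, .add _ _ h₁ hW, .congr _ _ h₂ fun ρ y hρ => ?_⟩
  rw [resOp_add hφ hδ h₁ hW hρ]
  ring

theorem trigLog_of_lower
    (hφ : ∀ ρ y, φ ρ y = ρ + δ y * Real.log ρ + (b₀ + b₁ y)) (hδ : ExpDecayAll δ)
    (ha : ExpDecayAll a) (hδa : ∀ y, δ y = (3 / 8) * β * (a y) ^ 2) (hk : k ≠ 0)
    {c : ℝ → ℝ} (hc : ExpDecayAll c) (θ : ℝ) (i : ℕ)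
    (h₁ : Removable β a φ k (trigLog φ
      (fun y => 3 / 4 * β * Real.sin θ / k * (a y * a y * c y)) 1 0 i (k + 1)))
    (h₂ : Removable β a φ k (trigLog φ (fun y => i / k * c y) 1 θ (i - 1) (k + 1))) :
    Removable β a φ k (trigLog φ c 1 θ i (k + 1)) := by
  have hd := hc.const_mul (-(2 * k : ℝ)⁻¹)
  refine of_resOp_add hφ hδ (orderSpan_trigLog hd 1 (θ + π / 2) i le_rfl) ?_
  refine ((of_nonresSpan (resOp_trigLog hφ hδ ha hδa hd (θ + π / 2) i k)).add hφ hδ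
    (h₁.add hφ hδ h₂)).congr fun ρ y hρ => ?_
  have hk' : (k : ℝ) ≠ 0 := by exact_mod_cast hk
  simp only [trigLog, Real.cos_add_pi_div_two θ, add_sub_cancel_right]
  field_simp
  ring

theorem trigLog
    (hφ : ∀ ρ y, φ ρ y = ρ + δ y * Real.log ρ + (b₀ + b₁ y)) (hδ : ExpDecayAll δ)
    (ha : ExpDecayAll a) (hδa : ∀ y, δ y = (3 / 8) * β * (a y) ^ 2) (hk : k ≠ 0)
    {c : ℝ → ℝ} (hc : ExpDecayAll c) (θ : ℝ) (i : ℕ) :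
    Removable β a φ k (trigLog φ c 1 θ i (k + 1)) := by
  have h₀ {c : ℝ → ℝ} (θ : ℝ) (i : ℕ) (h : ∀ y, c y = 0) :
      Removable β a φ k (_root_.trigLog φ c 1 θ i (k + 1)) :=
    (of_nonresSpan .zero).congr fun ρ y _ => by simp [_root_.trigLog, h]
  have hcos (c : ℝ → ℝ) (hc : ExpDecayAll c) (i : ℕ) :
      Removable β a φ k (_root_.trigLog φ c 1 0 i (k + 1)) := by
    induction i generalizing c with
    | zero => exact trigLog_of_lower hφ hδ ha hδa hk hc 0 0 (h₀ _ _ (by simp)) (h₀ _ _ (by simp))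
    | succ i ih =>
      exact trigLog_of_lower hφ hδ ha hδa hk hc 0 (i + 1) (h₀ _ _ (by simp))
        (ih _ (hc.const_mul _))
  induction i generalizing c with
  | zero =>
    exact trigLog_of_lower hφ hδ ha hδa hk hc θ 0
      (hcos _ (((ha.mul ha).mul hc).const_mul _) 0) (h₀ _ _ (by simp))
  | succ i ih =>
    exact trigLog_of_lower hφ hδ ha hδa hk hc θ (i + 1)
      (hcos _ (((ha.mul ha).mul hc).const_mul _) _) (ih (hc.const_mul _))

theorem of_orderSpan
    (hφ : ∀ ρ y, φ ρ y = ρ + δ y * Real.log ρ + (b₀ + b₁ y)) (hδ : ExpDecayAll δ)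
    (ha : ExpDecayAll a) (hδa : ∀ y, δ y = (3 / 8) * β * (a y) ^ 2) (hk : k ≠ 0)
    (hS : OrderSpan φ (k + 1) S) : Removable β a φ k S := by
  induction hS with
  | monomial c n θ i j hc hP =>
    by_cases h : k + 1 ≤ j ∧ (n.natAbs = 1 → k + 1 < j)
    · exact of_nonresSpan (.monomial c n θ i j hc h)
    · obtain ⟨hn, rfl⟩ : n.natAbs = 1 ∧ j = k + 1 := by omega
      rcases Int.natAbs_eq_iff.1 hn with rfl | rfl
      · exact trigLog hφ hδ ha hδa hk hc θ i
      · refine (trigLog hφ hδ ha hδa hk hc (-θ) i).congr fun ρ y _ => ?_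
        rw [_root_.trigLog, _root_.trigLog, ← Real.cos_neg]
        push_cast
        ring_nf
  | zero => exact of_nonresSpan .zero
  | add S T _ _ hS hT => exact hS.add hφ hδ hT
  | congr S T _ h hS => exact hS.congr h

end Removable

/-! ### The nonlinear operator -/

theorem Psi_add_sub
    (hφ : ∀ ρ y, φ ρ y = ρ + δ y * Real.log ρ + (b₀ + b₁ y)) (hδ : ExpDecayAll δ)
    (hb₁ : ExpDecayAll b₁) (ha : ExpDecayAll a) (hk : k ≠ 0) {V W : ℝ → ℝ → ℝ}
    (hV : OrderSpan φ 1 (fun ρ y => V ρ y - a y * Real.cos (φ ρ y))) (hW : OrderSpan φ k W) :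
    OrderSpan φ (k + 2) (fun ρ y => Psi β (fun ρ y => V ρ y + W ρ y) ρ y - Psi β V ρ y
      - resOp β a φ W ρ y) := by
  have hV₀ : OrderSpan φ 0 (fun ρ y => a y * Real.cos (φ ρ y)) :=
    .congr _ _ (orderSpan_trigLog ha 1 0 0 le_rfl) fun ρ y _ => by simp [trigLog]
  have hV' : OrderSpan φ 0 V :=
    .congr _ _ (.add _ _ (hV.of_le (by omega)) hV₀) fun ρ y _ => by ring
  have h₁ : OrderSpan φ (k + 2) _ := OrderSpan.of_le (by omega)
    (((hV.mul (.add _ _ hV' hV₀)).mul hW).div_pow 1)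
  have h₂ : OrderSpan φ (k + 2) _ := OrderSpan.of_le (by omega) (((hV'.mul hW).mul hW).div_pow 1)
  have h₃ : OrderSpan φ (k + 2) _ := OrderSpan.of_le (by omega) (((hW.mul hW).mul hW).div_pow 1)
  have h₄ := (orderSpan_deriv_deriv_snd hφ hδ hb₁ hW).div_pow 2
  refine .congr _ _ (.add _ _ (.const_mul (3 * β) (.add _ _ h₁ h₂)) (.add _ _ (.const_mul β h₃)
    (.sub (.const_mul (1 / 4) (hW.div_pow 2)) h₄))) fun ρ y hρ => ?_
  have e := oscOp_add hφ hδ hV' hW hρ y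
  simp only [oscOp] at e
  rw [Psi, Psi, resOp, oscOp, deriv_deriv_snd_add hφ hδ hb₁ hV' hW hρ y]
  field_simp
  linear_combination 4 * ρ ^ 2 * e

theorem nonresSpan_Psi_zero
    (hφ : ∀ ρ y, φ ρ y = ρ + δ y * Real.log ρ + (b₀ + b₁ y)) (hδ : ExpDecayAll δ)
    (hb₁ : ExpDecayAll b₁) (ha : ExpDecayAll a) (hδa : ∀ y, δ y = (3 / 8) * β * (a y) ^ 2) :
    NonresSpan φ 1 (Psi β (fun ρ y => a y * Real.cos (φ ρ y))) := by
  have e : (fun ρ y => a y * Real.cos (φ ρ y)) = trigLog φ a 1 0 0 0 := by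
    funext ρ y
    simp [trigLog]
  have hV : OrderSpan φ 0 (trigLog φ a 1 0 0 0) := orderSpan_trigLog ha 1 0 0 le_rfl
  have h₁ : OrderSpan φ 2 _ := .sub (.const_mul (1 / 4) (hV.div_pow 2))
    ((orderSpan_deriv_deriv_snd hφ hδ hb₁ hV).div_pow 2)
  rw [e]
  refine .congr _ _ (.add _ _ (.add _ _
    ((oscOp_trigLog hφ hδ ha 1 0 0 0).nonresSpan (by omega)) (h₁.nonresSpan (by omega)))
    (.const_mul (1 / 4 * β) (.monomial _ 3 0 0 1 ((ha.mul ha).mul ha) (by simp))))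
    fun ρ y hρ => ?_
  rw [Psi, oscOp]
  simp only [trigLog, Int.cast_one, one_mul, hδa, Int.cast_ofNat, add_zero, Real.cos_three_mul]
  field_simp
  push_cast
  ring

theorem exists_correction
    (hφ : ∀ ρ y, φ ρ y = ρ + δ y * Real.log ρ + (b₀ + b₁ y)) (hδ : ExpDecayAll δ)
    (hb₁ : ExpDecayAll b₁) (ha : ExpDecayAll a) (hδa : ∀ y, δ y = (3 / 8) * β * (a y) ^ 2)
    (hk : k ≠ 0) {V : ℝ → ℝ → ℝ}
    (hV : OrderSpan φ 1 (fun ρ y => V ρ y - a y * Real.cos (φ ρ y)))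
    (hΨ : NonresSpan φ k (Psi β V)) :
    ∃ W, OrderSpan φ k W ∧ NonresSpan φ (k + 1) (Psi β (fun ρ y => V ρ y + W ρ y)) := by
  obtain ⟨E, E', hE, hE', hEE'⟩ := hΨ.split (Q := fun n j => j = k ∧ n ≠ 1)
    (fun _ j => k + 1 ≤ j) (fun n j h => by omega)
  obtain ⟨X, hX, hXE⟩ := exists_oscOp_add_orderSpan hφ hδ hE
  have hV₀ : OrderSpan φ 0 (fun ρ y => a y * Real.cos (φ ρ y)) :=
    .congr _ _ (orderSpan_trigLog ha 1 0 0 le_rfl) fun ρ y _ => by simp [trigLog]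
  have h₁ : OrderSpan φ (k + 1) _ := OrderSpan.of_le (by omega)
    (((hV₀.mul hV₀).mul hX).div_pow 1)
  have hΨX : OrderSpan φ (k + 1) (Psi β (fun ρ y => V ρ y + X ρ y)) := by
    refine .congr _ _ (.add _ _ (OrderSpan.of_le (by omega)
      (Psi_add_sub (β := β) hφ hδ hb₁ ha hk hV hX))
      (.add _ _ hE' (.add _ _ hXE (.const_mul (3 * β) h₁)))) fun ρ y hρ => ?_
    rw [hEE' ρ y hρ, resOp]
    field_simp
    ring
  have hVX : OrderSpan φ 1 (fun ρ y => V ρ y + X ρ y - a y * Real.cos (φ ρ y)) :=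
    .congr _ _ (.add _ _ hV (OrderSpan.of_le (by omega) hX)) fun ρ y _ => by ring
  obtain ⟨Y, hY, hYΨ⟩ := Removable.of_orderSpan hφ hδ ha hδa hk hΨX
  refine ⟨_, .add _ _ hX hY, .congr _ _ (.add _ _ hYΨ
    ((Psi_add_sub (β := β) hφ hδ hb₁ ha hk hVX hY).nonresSpan (by omega))) fun ρ y hρ => ?_⟩
  simp only [add_assoc]
  ring

end Phase

/-- Construction of the full asymptotic series for `Ψ(V) = 0`: starting from
`V₀ = a(y) cos φ`, there is a sequence `V_k` with `V_k − V₀ ∈ S_1`,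
`Ψ(V_k) ∈ S°_{k+1}` and `V_k − V_{k−1} ∈ S_k`. -/
theorem asymptotic_series_construction (β : ℝ) (a b₁ : ℝ → ℝ) (b₀ : ℝ)
    (ha : ContDiff ℝ (⊤ : ℕ∞) a) (hb₁ : ContDiff ℝ (⊤ : ℕ∞) b₁)
    (hdecay : ∀ N l : ℕ, ∃ C : ℝ, ∀ y : ℝ,
      |iteratedDeriv l a y| + |iteratedDeriv l b₁ y| ≤ C * Real.exp (-(N : ℝ) * |y|))
    (δ : ℝ → ℝ) (hδ : ∀ y, δ y = (3 / 8) * β * (a y) ^ 2)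
    (φ : ℝ → ℝ → ℝ) (hφ : ∀ ρ y, φ ρ y = ρ + δ y * Real.log ρ + (b₀ + b₁ y)) :
    ∃ V : ℕ → ℝ → ℝ → ℝ,
      (∀ ρ y : ℝ, V 0 ρ y = a y * Real.cos (φ ρ y)) ∧
      (∀ k : ℕ, MemS φ 1 (fun ρ y => V k ρ y - V 0 ρ y)) ∧
      (∀ k : ℕ, MemS0 φ (k + 1) (fun ρ y => Psi β (V k) ρ y)) ∧
      (∀ k : ℕ, 1 ≤ k → MemS φ k (fun ρ y => V k ρ y - V (k - 1) ρ y)) := by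
  have ha' : ExpDecayAll a := ⟨ha, fun N l => (hdecay N l).imp fun C hC y =>
    (le_add_of_nonneg_right (abs_nonneg _)).trans (hC y)⟩
  have hb' : ExpDecayAll b₁ := ⟨hb₁, fun N l => (hdecay N l).imp fun C hC y =>
    (le_add_of_nonneg_left (abs_nonneg _)).trans (hC y)⟩
  have hδ' : ExpDecayAll δ := by
    convert (ha'.mul ha').const_mul (3 / 8 * β) using 2 with y
    rw [hδ, sq]
  have hstep (k : ℕ) (V : ℝ → ℝ → ℝ) : ∃ W : ℝ → ℝ → ℝ,
      OrderSpan φ 1 (fun ρ y => V ρ y - a y * Real.cos (φ ρ y)) →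
      NonresSpan φ (k + 1) (Psi β V) →
      OrderSpan φ (k + 1) W ∧ NonresSpan φ (k + 2) (Psi β (fun ρ y => V ρ y + W ρ y)) := by
    by_cases h : OrderSpan φ 1 (fun ρ y => V ρ y - a y * Real.cos (φ ρ y)) ∧
      NonresSpan φ (k + 1) (Psi β V)
    · obtain ⟨W, hW⟩ := exists_correction hφ hδ' hb' ha' hδ k.succ_ne_zero h.1 h.2
      exact ⟨W, fun _ _ => hW⟩
    · exact ⟨0, fun h₁ h₂ => absurd ⟨h₁, h₂⟩ h⟩
  choose W hW using hstep
  let V : ℕ → ℝ → ℝ → ℝ := fun k =>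
    Nat.rec (fun ρ y => a y * Real.cos (φ ρ y)) (fun k V ρ y => V ρ y + W k V ρ y) k
  have hV (k : ℕ) : OrderSpan φ 1 (fun ρ y => V k ρ y - a y * Real.cos (φ ρ y)) ∧
      NonresSpan φ (k + 1) (Psi β (V k)) := by
    induction k with
    | zero => exact ⟨.congr _ _ .zero fun ρ y _ => by simp [V],
        nonresSpan_Psi_zero hφ hδ' hb' ha' hδ⟩
    | succ k ih =>
      obtain ⟨h₁, h₂⟩ := hW k (V k) ih.1 ih.2
      refine ⟨.congr _ _ (.add _ _ ih.1 (OrderSpan.of_le (by omega) h₁)) fun ρ y _ => ?_, h₂⟩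
      simp only [V]
      ring
  refine ⟨V, fun ρ y => rfl, fun k => (hV k).1.memS, fun k => (hV k).2.memS0, fun k hk => ?_⟩
  obtain ⟨k, rfl⟩ := Nat.exists_eq_add_of_le' hk
  refine TrigLogSpan.memS (.congr _ _ (hW k (V k) (hV k).1 (hV k).2).1 fun ρ y _ => ?_)
  simp only [V, Nat.add_sub_cancel]
  ring
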